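/- Let F_q be a finite field and f ∈ F_q[T] a non-constant polynomial of degree d. If d ≤ q/2, then there exists a polynomial g ∈ F_q[T], coprime to f, such that g/f is normal. -/

import Mathlib

noncomputable section

namespace PaperCF

variable {K : Type*} [Field K]

/-- The element `T` of `K((T⁻¹))`, where `K((T⁻¹))` is modeled as the field
`LaurentSeries K` of Laurent series in the variable `t = T⁻¹`. -/
def Tvar (K : Type*) [Field K] : LaurentSeries K := (HahnSeries.single (-1 : ℤ) (1 : K))

/-- The embedding of `K[T]` into `K((T⁻¹))`, sending the polynomial variable to `T = t⁻¹`. -/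
def emb : Polynomial K →+* LaurentSeries K := (Polynomial.aeval (Tvar K)).toRingHom

/-- The polynomial part `⌊α⌋` of a formal Laurent series `α ∈ K((T⁻¹))`. -/
def polyPart (α : LaurentSeries K) : Polynomial K :=
  ∑ i ∈ Finset.range ((-α.order).toNat + 1), Polynomial.monomial i (α.coeff (-(i : ℤ)))

/-- The complete quotients `αₙ` of the regular continued fraction expansion of `α`
(with the convention `0⁻¹ = 0`, so that `cq α n = 0` for all `n` past the end of a
finite expansion). -/
def cq (α : LaurentSeries K) : ℕ → LaurentSeries K
  | 0 => α
  | n + 1 => (cq α n - emb (polyPart (cq α n)))⁻¹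

/-- The partial quotients `aₙ = ⌊αₙ⌋` of the regular continued fraction expansion of `α`. -/
def pq (α : LaurentSeries K) (n : ℕ) : Polynomial K := polyPart (cq α n)

/-- The continuants `(pₙ, qₙ)` of the regular continued fraction expansion of `α`. -/
def cont (α : LaurentSeries K) : ℕ → Polynomial K × Polynomial K
  | 0 => (pq α 0, 1)
  | 1 => (pq α 1 * pq α 0 + 1, pq α 1)
  | n + 2 => (pq α (n + 2) * (cont α (n + 1)).1 + (cont α n).1,
              pq α (n + 2) * (cont α (n + 1)).2 + (cont α n).2)

/-- `pₙ`. -/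
def contP (α : LaurentSeries K) (n : ℕ) : Polynomial K := (cont α n).1

/-- `qₙ`. -/
def contQ (α : LaurentSeries K) (n : ℕ) : Polynomial K := (cont α n).2

/-- The `n`-th partial quotient (and hence the `n`-th convergent) of `α` genuinely exists. -/
def ConvAt (α : LaurentSeries K) (n : ℕ) : Prop := n = 0 ∨ cq α n ≠ 0

/-- `K(α) = sup_{n ≥ 1} deg aₙ`, as an extended natural number. -/
def KK (α : LaurentSeries K) : ℕ∞ :=
  ⨆ n : {n : ℕ // 1 ≤ n ∧ cq α n ≠ 0}, ((pq α n.1).natDegree : ℕ∞)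

/-- `ōK(α) = limsup_n deg aₙ`. -/
def KKbar (α : LaurentSeries K) : ℕ∞ :=
  Filter.limsup (fun n => ((pq α n).natDegree : ℕ∞)) Filter.atTop

/-- `α` is a rational function, i.e. an element of `K(T) ⊆ K((T⁻¹))`. -/
def IsRat (α : LaurentSeries K) : Prop :=
  ∃ p q : Polynomial K, q ≠ 0 ∧ α * emb q = emb p

/-- Two Laurent series are equivalent if they differ by a Möbius transformation with
matrix in `GL₂(K[T])`. -/
def MEquiv (α β : LaurentSeries K) : Prop :=
  ∃ a b c d : Polynomial K, IsUnit (a * d - b * c) ∧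
    emb c * α + emb d ≠ 0 ∧ β = (emb a * α + emb b) / (emb c * α + emb d)

end PaperCF

namespace PaperCF

open Polynomial

section ContinuedFraction

variable {K : Type*} [Field K]

lemma emb_monomial (n : ℕ) (a : K) :
    emb (monomial n a) = (HahnSeries.single (-(n : ℤ)) a : LaurentSeries K) := by
  have h : emb (monomial n a) = algebraMap K (LaurentSeries K) a * Tvar K ^ n := by
    simp [emb, aeval_monomial]
  rw [h, Tvar, HahnSeries.single_pow, HahnSeries.algebraMap_apply',
    PowerSeries.algebraMap_apply, HahnSeries.ofPowerSeries_C]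
  simp

lemma coeff_emb (p : K[X]) (i : ℕ) : (emb p).coeff (-(i : ℤ)) = p.coeff i := by
  induction p using Polynomial.induction_on' with
  | add p q hp hq => simp [map_add, hp, hq]
  | monomial n a =>
    rw [emb_monomial, HahnSeries.coeff_single, coeff_monomial]
    by_cases h : n = i
    · simp [h]
    · rw [if_neg h, if_neg (by omega)]

lemma emb_ne_zero {p : K[X]} (hp : p ≠ 0) : emb p ≠ 0 := by
  intro h
  apply hp
  ext i
  rw [← coeff_emb, h]
  simp

lemma order_emb {p : K[X]} (hp : p ≠ 0) : (emb p).order = -(p.natDegree : ℤ) := by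
  apply le_antisymm
  · apply HahnSeries.order_le_of_coeff_ne_zero
    rw [coeff_emb]
    simpa using hp
  · by_contra! h
    obtain ⟨i, hi⟩ : ∃ i : ℕ, (emb p).order = -(i : ℤ) :=
      ⟨((-(emb p).order).toNat), by omega⟩
    have h0 : (emb p).coeff (emb p).order ≠ 0 := HahnSeries.coeff_order_eq_zero.not.mpr (emb_ne_zero hp)
    rw [hi, coeff_emb] at h0
    exact h0 (coeff_eq_zero_of_natDegree_lt (by omega))

lemma coeff_polyPart (α : LaurentSeries K) (i : ℕ) :
    (polyPart α).coeff i = α.coeff (-(i : ℤ)) := by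
  simp only [polyPart, finsetSum_coeff, coeff_monomial, Finset.sum_ite_eq', Finset.mem_range]
  split_ifs with h
  · rfl
  · exact (HahnSeries.coeff_eq_zero_of_lt_order (by omega)).symm

lemma coeff_emb_div_eq_zero {r b : K[X]} (h : r.degree < b.degree) (i : ℕ) :
    (emb r / emb b).coeff (-(i : ℤ)) = 0 := by
  by_cases hr : r = 0
  · simp [hr]
  have hb : b ≠ 0 := by rintro rfl; simp at h
  have hε : emb r / emb b ≠ 0 := div_ne_zero (emb_ne_zero hr) (emb_ne_zero hb)
  have hmul : emb r / emb b * emb b = emb r := div_mul_cancel₀ _ (emb_ne_zero hb)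
  have ho := HahnSeries.order_mul hε (emb_ne_zero hb)
  rw [hmul, order_emb hr, order_emb hb] at ho
  have := natDegree_lt_natDegree hr h
  exact HahnSeries.coeff_eq_zero_of_lt_order (by omega)

lemma emb_div_emb (a : K[X]) {b : K[X]} (hb : b ≠ 0) :
    emb a / emb b = emb (a / b) + emb (a % b) / emb b := by
  have := emb_ne_zero hb
  field_simp
  rw [← map_mul, ← map_add, EuclideanDomain.div_add_mod]

lemma polyPart_emb_div_emb (a b : K[X]) : polyPart (emb a / emb b) = a / b := by
  ext i
  rw [coeff_polyPart]
  by_cases hb : b = 0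
  · simp [hb]
  rw [emb_div_emb a hb, HahnSeries.coeff_add, coeff_emb,
    coeff_emb_div_eq_zero (EuclideanDomain.mod_lt a hb), add_zero]

lemma cq_succ_eq (α : LaurentSeries K) (k : ℕ) :
    cq α (k + 1) = cq (α - emb (polyPart α))⁻¹ k := by
  induction k with
  | zero => rfl
  | succ k ih => rw [cq, ih, ← cq]

lemma cq_emb_div_emb_succ (a : K[X]) {b : K[X]} (hb : b ≠ 0) (k : ℕ) :
    cq (emb a / emb b) (k + 1) = cq (emb b / emb (a % b)) k := by
  rw [cq_succ_eq, polyPart_emb_div_emb, emb_div_emb a hb, add_sub_cancel_left, inv_div]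

lemma cq_zero (k : ℕ) : cq (0 : LaurentSeries K) k = 0 := by
  have h0 : polyPart (0 : LaurentSeries K) = 0 := by ext i; simp [coeff_polyPart]
  induction k with
  | zero => rfl
  | succ k ih => simp [cq, ih, h0]

lemma natDegree_div_eq_sub (a : K[X]) {b : K[X]} (hb : b ≠ 0) :
    (a / b).natDegree = a.natDegree - b.natDegree := by
  have hu := inv_ne_zero (leadingCoeff_ne_zero.mpr hb)
  rw [div_def, natDegree_C_mul hu, natDegree_divByMonic _ (monic_mul_leadingCoeff_inv hb),
    natDegree_mul_C hu]

/-- If the multiples `Q * g` have no small residues modulo `f`, then every quotient in the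
Euclidean algorithm for `f` and `g` has degree one. -/
lemma natDegree_pq_eq_one {f g : K[X]}
    (H : ∀ Q R : K[X], Q ≠ 0 → Q.natDegree < f.natDegree → f ∣ Q * g - R →
      R ≠ 0 ∧ f.natDegree ≤ R.natDegree + Q.natDegree + 1) (e : ℕ) :
    ∀ a b Q₀ Q₁ : K[X], a.natDegree = e + 1 → b ≠ 0 → b.natDegree = e →
      Q₁ ≠ 0 → Q₁.natDegree + e + 1 = f.natDegree → Q₀.degree < Q₁.degree →
      f ∣ Q₀ * g - a → f ∣ Q₁ * g - b →
      ∀ k, cq (emb a / emb b) k ≠ 0 → (pq (emb a / emb b) k).natDegree = 1 := by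
  induction e with
  | zero =>
    intro a b Q₀ Q₁ ha hb hbd _ _ _ _ _ k hk
    cases k with
    | zero => rw [pq, cq, polyPart_emb_div_emb, natDegree_div_eq_sub a hb, ha, hbd]
    | succ k =>
      have hm : a % b = 0 :=
        EuclideanDomain.mod_eq_zero.mpr
          ((isUnit_iff_degree_eq_zero.mpr (by rw [degree_eq_natDegree hb, hbd]; rfl)).dvd)
      rw [cq_emb_div_emb_succ a hb, hm, map_zero, div_zero, cq_zero] at hk
      exact absurd rfl hk
  | succ e ih =>
    intro a b Q₀ Q₁ ha hb hbd hQ₁ hQd hQ hfa hfb k hk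
    have hd : (a / b).natDegree = 1 := by rw [natDegree_div_eq_sub a hb, ha, hbd]; omega
    cases k with
    | zero => rw [pq, cq, polyPart_emb_div_emb, hd]
    | succ k =>
      have hc0 : a / b ≠ 0 := by rintro h; simp [h] at hd
      have hlt : Q₀.degree < (a / b * Q₁).degree := by
        refine hQ.trans_le ?_
        rw [mul_comm]
        exact degree_le_mul_left _ hc0
      have hdeg : (Q₀ - a / b * Q₁).degree = (a / b * Q₁).degree :=
        degree_sub_eq_right_of_degree_lt hlt
      have hnd : (Q₀ - a / b * Q₁).natDegree = Q₁.natDegree + 1 := by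
        rw [natDegree_eq_of_degree_eq hdeg, natDegree_mul hc0 hQ₁, hd, add_comm]
      have hne : Q₀ - a / b * Q₁ ≠ 0 := by rintro h; simp [h] at hnd
      have hdvd : f ∣ (Q₀ - a / b * Q₁) * g - a % b := by
        have h1 : (Q₀ - a / b * Q₁) * g - a % b
            = (Q₀ * g - a) - a / b * (Q₁ * g - b) := by
          linear_combination -EuclideanDomain.div_add_mod a b
        rw [h1]
        exact dvd_sub hfa (hfb.mul_left _)
      obtain ⟨hm0, hmd⟩ := H _ _ hne (by omega) hdvd
      have hmlt := natDegree_lt_natDegree hm0 (EuclideanDomain.mod_lt a hb)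
      have hlt' : Q₁.degree < (Q₀ - a / b * Q₁).degree :=
        degree_lt_degree (by omega)
      rw [cq_emb_div_emb_succ a hb] at hk
      rw [pq, cq_emb_div_emb_succ a hb, ← pq]
      exact ih b (a % b) Q₁ _ hbd hm0 (by omega) hne (by omega) hlt' hfb hdvd k hk

lemma KK_emb_div_emb_eq_one {f g : K[X]} (hf : 0 < f.natDegree) (hg : g.degree < f.degree)
    (H : ∀ Q R : K[X], Q ≠ 0 → Q.natDegree < f.natDegree → f ∣ Q * g - R →
      R ≠ 0 ∧ f.natDegree ≤ R.natDegree + Q.natDegree + 1) :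
    KK (emb g / emb f) = 1 := by
  have hf0 : f ≠ 0 := by rintro rfl; simp at hf
  obtain ⟨hg0, hgd⟩ := H 1 g one_ne_zero (by simpa using hf) (by simp)
  have hgl := natDegree_lt_natDegree hg0 hg
  rw [natDegree_one] at hgd
  have hmod : g % f = g := (mod_eq_self_iff hf0).mpr hg
  have hshift (k : ℕ) : cq (emb g / emb f) (k + 1) = cq (emb f / emb g) k := by
    rw [cq_emb_div_emb_succ g hf0, hmod]
  have key (k : ℕ) (hk : cq (emb g / emb f) (k + 1) ≠ 0) :
      (pq (emb g / emb f) (k + 1)).natDegree = 1 := by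
    rw [hshift] at hk
    rw [pq, hshift, ← pq]
    exact natDegree_pq_eq_one H g.natDegree f g 0 1 (by omega) hg0 rfl one_ne_zero
      (by simp; omega) (by simp) (by simp) (by simp) k hk
  have hne : cq (emb g / emb f) 1 ≠ 0 := by
    rw [hshift]
    exact div_ne_zero (emb_ne_zero hf0) (emb_ne_zero hg0)
  apply le_antisymm
  · refine iSup_le ?_
    rintro ⟨n, hn, hc⟩
    obtain ⟨k, rfl⟩ := Nat.exists_eq_add_of_le' hn
    rw [key k hc]
    rfl
  · refine le_iSup_of_le (⟨1, le_rfl, hne⟩ : {n : ℕ // 1 ≤ n ∧ cq (emb g / emb f) n ≠ 0}) ?_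
    rw [key 0 hne]
    rfl

end ContinuedFraction

section Counting

open Classical in
lemma card_normalizedFactors_le_natDegree {K : Type*} [Field K] {f : K[X]} (hf : f ≠ 0) :
    (UniqueFactorizationMonoid.normalizedFactors f).card ≤ f.natDegree := by
  have hprod := UniqueFactorizationMonoid.prod_normalizedFactors hf
  rw [← natDegree_eq_of_degree_eq (degree_eq_degree_of_associated hprod),
    natDegree_multiset_prod _ (UniqueFactorizationMonoid.zero_notMem_normalizedFactors f)]
  refine le_of_eq_of_le ?_ (Multiset.card_nsmul_le_sum (a := 1) ?_)
  · simp
  · intro n hn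
    obtain ⟨p, hp, rfl⟩ := Multiset.mem_map.mp hn
    exact (UniqueFactorizationMonoid.irreducible_of_normalized_factor p hp).natDegree_pos

variable (K : Type*) [Field K] [Fintype K]

/-- The finite set of polynomials of degree less than `n`. -/
def polysLT (n : ℕ) : Finset K[X] :=
  haveI : Finite (degreeLT K n) := Finite.of_equiv _ (degreeLTEquiv K n).symm.toEquiv
  (Set.toFinite (degreeLT K n : Set K[X])).toFinset

variable {K}

lemma mem_polysLT {n : ℕ} {p : K[X]} : p ∈ polysLT K n ↔ p.degree < n := by
  simp [polysLT, mem_degreeLT]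

lemma card_polysLT (n : ℕ) : (polysLT K n).card = Fintype.card K ^ n := by
  rw [polysLT, ← Set.ncard_eq_toFinset_card _ _]
  change Nat.card (degreeLT K n) = _
  rw [Nat.card_congr (degreeLTEquiv K n).toEquiv]
  simp

open Classical in
/-- The multiples of a non-constant polynomial among those of degree less than `n`. -/
lemma card_filter_dvd_le {p : K[X]} (hp : 0 < p.natDegree) (n : ℕ) :
    ((polysLT K n).filter (p ∣ ·)).card ≤ Fintype.card K ^ (n - 1) := by
  rw [← card_polysLT (n - 1)]
  refine (Finset.card_le_card ?_).trans (Finset.card_image_le (f := (p * ·)))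
  intro g hg
  obtain ⟨hgn, h, rfl⟩ := Finset.mem_filter.mp hg
  refine Finset.mem_image.mpr ⟨h, ?_, rfl⟩
  rw [mem_polysLT] at hgn ⊢
  by_cases h0 : h = 0
  · simp [h0]
  have hp0 : p ≠ 0 := by rintro rfl; simp at hp
  rw [← natDegree_lt_iff_degree_lt (mul_ne_zero hp0 h0), natDegree_mul hp0 h0] at hgn
  rw [← natDegree_lt_iff_degree_lt h0]
  omega

open Classical in
/-- The polynomials of degree less than `deg f` and not coprime to `f`. -/
lemma card_filter_not_isCoprime_le {f : K[X]} (hf : f ≠ 0) :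
    ((polysLT K f.natDegree).filter (¬ IsCoprime · f)).card
      ≤ f.natDegree * Fintype.card K ^ (f.natDegree - 1) := by
  set S := (UniqueFactorizationMonoid.normalizedFactors f).toFinset
  have hS : S.card ≤ f.natDegree :=
    (Multiset.toFinset_card_le _).trans (card_normalizedFactors_le_natDegree hf)
  refine (Finset.card_le_card (t := S.biUnion fun p ↦
    (polysLT K f.natDegree).filter (p ∣ ·)) ?_).trans ?_
  · intro g hg
    obtain ⟨hgn, hc⟩ := Finset.mem_filter.mp hg
    obtain ⟨p, hp, hpg, hpf⟩ : ∃ p, Irreducible p ∧ p ∣ g ∧ p ∣ f := by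
      by_contra! hno
      exact hc (isCoprime_of_irreducible_dvd (fun h ↦ hf h.2) hno)
    obtain ⟨p', hp', hass⟩ := UniqueFactorizationMonoid.exists_mem_normalizedFactors_of_dvd hf hp hpf
    simp only [Finset.mem_biUnion, Finset.mem_filter]
    exact ⟨p', Multiset.mem_toFinset.mpr hp', hgn, hass.symm.dvd.trans hpg⟩
  · refine Finset.card_biUnion_le.trans ((Finset.sum_le_card_nsmul _ _ _ ?_).trans
      (Nat.mul_le_mul_right _ hS))
    intro p hp
    exact card_filter_dvd_le (UniqueFactorizationMonoid.irreducible_of_normalized_factor p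
      (Multiset.mem_toFinset.mp hp)).natDegree_pos _

open Classical in
/-- The polynomials `g` of degree less than `deg f` and coprime to `f` for which `Q * g` has a
residue of degree less than `m` modulo `f`. -/
lemma card_filter_small_residue_le {f Q : K[X]} (hf : f ≠ 0) (hQ0 : Q ≠ 0)
    (hQ : Q.natDegree < f.natDegree) (m : ℕ) :
    ((polysLT K f.natDegree).filter fun g ↦
      IsCoprime g f ∧ ∃ R : K[X], R.degree < m ∧ f ∣ Q * g - R).card ≤ Fintype.card K ^ m := by
  obtain ⟨D, Q', f', hcop, hDQ, hDf⟩ : ∃ D Q' f' : K[X], IsCoprime Q' f' ∧ Q = D * Q' ∧ f = D * f' := by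
    let := EuclideanDomain.gcdMonoid K[X]
    obtain ⟨Q', f', hQ', hf', h⟩ := extract_gcd Q f
    exact ⟨_, Q', f', (gcd_isUnit_iff _ _).mp h, hQ', hf'⟩
  have hD0 : D ≠ 0 := by rintro rfl; simp at hDf; exact hf hDf
  have hf'0 : f' ≠ 0 := by rintro rfl; simp at hDf; exact hf hDf
  have hdeg : f.natDegree = D.natDegree + f'.natDegree := by rw [hDf, natDegree_mul hD0 hf'0]
  obtain ⟨c, e, hce⟩ := hcop
  have hmain : ∀ g : K[X], IsCoprime g f → ∀ R : K[X], R.degree < m → f ∣ Q * g - R →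
      D.natDegree ≤ m ∧ ∃ R' : K[X], R'.degree < (m - D.natDegree : ℕ) ∧ f' ∣ g - c * R' := by
    intro g hg R hR hfR
    have hR0 : R ≠ 0 := by
      rintro rfl
      rw [sub_zero] at hfR
      exact hQ.not_ge (natDegree_le_of_dvd (hg.symm.dvd_of_dvd_mul_right hfR) hQ0)
    obtain ⟨R', rfl⟩ : D ∣ R := by
      have h1 : D ∣ Q * g - R := (Dvd.intro _ hDf.symm).trans hfR
      have h2 : D ∣ Q * g := (Dvd.intro _ hDQ.symm).mul_right g
      exact (dvd_sub_right h2).mp h1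
    have hR'0 : R' ≠ 0 := right_ne_zero_of_mul hR0
    rw [← natDegree_lt_iff_degree_lt hR0, natDegree_mul hD0 hR'0] at hR
    refine ⟨by omega, R', ?_, ?_⟩
    · rw [← natDegree_lt_iff_degree_lt hR'0]
      omega
    · have h1 : f' ∣ Q' * g - R' := by
        rw [hDf, hDQ, mul_assoc, ← mul_sub] at hfR
        exact (mul_dvd_mul_iff_left hD0).mp hfR
      have h2 : g - c * R' = c * (Q' * g - R') + f' * (e * g) := by
        linear_combination -g * hce
      rw [h2]
      exact dvd_add (h1.mul_left _) (dvd_mul_right _ _)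
  rcases Finset.eq_empty_or_nonempty ((polysLT K f.natDegree).filter fun g ↦
      IsCoprime g f ∧ ∃ R : K[X], R.degree < m ∧ f ∣ Q * g - R) with h | ⟨g₀, hg₀⟩
  · simp [h]
  obtain ⟨-, hg₀c, R₀, hR₀, hfR₀⟩ := Finset.mem_filter.mp hg₀
  have hDm := (hmain g₀ hg₀c R₀ hR₀ hfR₀).1
  have hcard : (polysLT K D.natDegree ×ˢ polysLT K (m - D.natDegree)).card
      = Fintype.card K ^ m := by
    rw [Finset.card_product, card_polysLT, card_polysLT, ← pow_add, Nat.add_sub_cancel' hDm]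
  rw [← hcard]
  refine (Finset.card_le_card ?_).trans
    (Finset.card_image_le (f := fun x : K[X] × K[X] ↦ f' * x.1 + (c * x.2) % f'))
  intro g hg
  obtain ⟨hgn, hgc, R, hR, hfR⟩ := Finset.mem_filter.mp hg
  obtain ⟨-, R', hR', hfR'⟩ := hmain g hgc R hR hfR
  refine Finset.mem_image.mpr ⟨(g / f', R'), Finset.mem_product.mpr ⟨?_, mem_polysLT.mpr hR'⟩, ?_⟩
  · rw [mem_polysLT] at hgn ⊢
    by_cases h0 : g / f' = 0
    · simp [h0]
    have hg0 : g ≠ 0 := by rintro rfl; simp at h0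
    rw [← natDegree_lt_iff_degree_lt hg0] at hgn
    rw [← natDegree_lt_iff_degree_lt h0, natDegree_div_eq_sub g hf'0]
    have : ¬ g.degree < f'.degree := fun h ↦ h0 ((Polynomial.div_eq_zero_iff hf'0).mpr h)
    have := natDegree_le_natDegree (not_lt.mp this)
    omega
  · have h1 : (c * R') % f' = g % f' := by
      have := EuclideanDomain.mod_eq_zero.mpr hfR'
      rw [sub_mod, sub_eq_zero] at this
      exact this.symm
    simp only [h1]
    exact EuclideanDomain.div_add_mod g f'

open Classical in
lemma exists_isCoprime_forall_residue {f : K[X]} (hf : 0 < f.natDegree)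
    (hq : 2 * f.natDegree ≤ Fintype.card K) :
    ∃ g : K[X], g.degree < f.degree ∧ IsCoprime g f ∧
      ∀ Q R : K[X], Q ≠ 0 → Q.natDegree < f.natDegree → f ∣ Q * g - R →
        R ≠ 0 ∧ f.natDegree ≤ R.natDegree + Q.natDegree + 1 := by
  have hf0 : f ≠ 0 := by rintro rfl; simp at hf
  obtain ⟨d, hd⟩ : ∃ d, f.natDegree = d + 1 := ⟨_, (Nat.succ_pred_eq_of_pos hf).symm⟩
  set q := Fintype.card K
  let A := (polysLT K f.natDegree).filter (¬ IsCoprime · f)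
  let B (Q : K[X]) (m : ℕ) := (polysLT K f.natDegree).filter fun g ↦
      IsCoprime g f ∧ ∃ R : K[X], R.degree < m ∧ f ∣ Q * g - R
  let S := (Finset.range d).biUnion fun j ↦ (polysLT K j).biUnion fun P ↦ B (X ^ j + P) (d - j)
  have hA : A.card ≤ (d + 1) * q ^ d := by
    simpa [A, hd] using card_filter_not_isCoprime_le hf0
  have hS : S.card ≤ d * q ^ d := by
    refine Finset.card_biUnion_le.trans ((Finset.sum_le_card_nsmul _ _ (q ^ d) ?_).trans
      (by simp))
    intro j hj
    rw [Finset.mem_range] at hj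
    refine Finset.card_biUnion_le.trans ((Finset.sum_le_card_nsmul _ _ (q ^ (d - j)) ?_).trans ?_)
    · intro P hP
      rw [mem_polysLT] at hP
      have hm : (X ^ j + P).Monic := monic_X_pow_add hP
      refine card_filter_small_residue_le hf0 hm.ne_zero ?_ _
      rw [natDegree_add_eq_left_of_degree_lt (by rwa [degree_X_pow]), natDegree_X_pow]
      omega
    · rw [card_polysLT, smul_eq_mul, ← pow_add, Nat.add_sub_cancel' hj.le]
  have hlt : (A ∪ S).card < (polysLT K f.natDegree).card := by
    rw [card_polysLT, hd, pow_succ']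
    refine (Finset.card_union_le _ _).trans_lt ?_
    have hq0 : 0 < q ^ d := pow_pos Fintype.card_pos _
    nlinarith
  obtain ⟨g, hg, hgAS⟩ := Finset.exists_mem_notMem_of_card_lt_card hlt
  rw [Finset.mem_union, not_or] at hgAS
  have hgf : IsCoprime g f := by
    by_contra h
    exact hgAS.1 (Finset.mem_filter.mpr ⟨hg, h⟩)
  refine ⟨g, by rw [degree_eq_natDegree hf0]; exact mem_polysLT.mp hg, hgf, ?_⟩
  intro Q R hQ0 hQd hdvd
  have hR0 : R ≠ 0 := by
    rintro rfl
    rw [sub_zero] at hdvd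
    exact hQd.not_ge (natDegree_le_of_dvd (hgf.symm.dvd_of_dvd_mul_right hdvd) hQ0)
  refine ⟨hR0, ?_⟩
  by_contra! hlt'
  apply hgAS.2
  have hu : Q.leadingCoeff⁻¹ ≠ 0 := inv_ne_zero (leadingCoeff_ne_zero.mpr hQ0)
  have hmon : (C Q.leadingCoeff⁻¹ * Q).Monic := by
    rw [mul_comm]; exact monic_mul_leadingCoeff_inv hQ0
  have hnd : (C Q.leadingCoeff⁻¹ * Q).natDegree = Q.natDegree := natDegree_C_mul hu
  simp only [S, B, Finset.mem_biUnion, Finset.mem_filter, Finset.mem_range]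
  refine ⟨Q.natDegree, by omega, C Q.leadingCoeff⁻¹ * Q - X ^ Q.natDegree, ?_, hg, hgf,
    C Q.leadingCoeff⁻¹ * R, ?_, ?_⟩
  · rw [mem_polysLT]
    have h := degree_sub_lt_left (p := C Q.leadingCoeff⁻¹ * Q) (q := X ^ Q.natDegree)
      (by rw [degree_eq_natDegree hmon.ne_zero, hnd, degree_X_pow]) hmon.ne_zero
      (by rw [hmon.leadingCoeff, leadingCoeff_X_pow])
    rwa [degree_eq_natDegree hmon.ne_zero, hnd] at h
  · rw [degree_C_mul hu, ← natDegree_lt_iff_degree_lt hR0]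
    omega
  · rw [add_sub_cancel, mul_assoc, ← mul_sub]
    exact hdvd.mul_left _

end Counting

end PaperCF

open PaperCF in
/-- **Friesen.** If `f ∈ F_q[T]` is non-constant of degree `d ≤ q/2`, then
there exists `g` coprime to `f` such that `g/f` is normal. -/
theorem zaremba_finite_field_of_two_mul_degree_le_card {K : Type*} [Field K] [Fintype K]
    (f : Polynomial K) (hf : 0 < f.natDegree)
    (hq : 2 * f.natDegree ≤ Fintype.card K) :
    ∃ g : Polynomial K, IsCoprime g f ∧ KK (emb g / emb f) = 1 := by
  obtain ⟨g, hgd, hgf, H⟩ := exists_isCoprime_forall_residue hf hq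
  exact ⟨g, hgf, KK_emb_div_emb_eq_one hf hgd H⟩
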